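/- Let $V$ be a finite-dimensional real normed vector space, $f:V\to V$ an invertible linear map, and $C\subseteq V$ a closed convex cone with $f(C)=C$, such that $C$ spans $V$ and contains no line. Suppose $x$ lies in the interior of $C$ and the limit $y:=\lim_{n\to\infty} f^n(x)/\|f^n(x)\|$ exists. Then $f(y)=ry$ where $r$ is the spectral radius of $f$. -/

import Mathlib

open Filter Topology
open scoped TensorProduct

open scoped Pointwise in
/-- A closed salient convex cone in a finite-dimensional space is normal. -/
theorem ConvexCone.exists_norm_le_mul_norm_of_isClosed {V : Type*} [NormedAddCommGroup V]
    [NormedSpace ℝ V] [FiniteDimensional ℝ V] (C : ConvexCone ℝ V)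
    (hCcl : IsClosed (C : Set V)) (hCsal : ∀ v ∈ C, -v ∈ C → v = 0) :
    ∃ K : ℝ, 0 ≤ K ∧ ∀ a b : V, a ∈ C → b - a ∈ C → ‖a‖ ≤ K * ‖b‖ := by
  have : ProperSpace V := FiniteDimensional.proper ℝ V
  have hS : IsCompact (Metric.sphere (0 : V) 1 ∩ (C : Set V)) :=
    (isCompact_sphere _ _).inter_right hCcl
  have hcl := hCcl.add_left_of_isCompact hS
  have h0 : (0 : V) ∈ (Metric.sphere (0 : V) 1 ∩ (C : Set V) + (C : Set V))ᶜ := by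
    rintro ⟨a, ⟨ha1, haC⟩, c, hc, hac⟩
    have hca : c = -a := eq_neg_of_add_eq_zero_right hac
    have := hCsal a haC (hca ▸ hc)
    simp [this] at ha1
  obtain ⟨δ, hδ, hball⟩ := Metric.isOpen_iff.1 hcl.isOpen_compl 0 h0
  refine ⟨δ⁻¹, by positivity, fun a b ha hba => ?_⟩
  rcases eq_or_ne a 0 with rfl | ha0
  · simp only [norm_zero]; positivity
  have hn : 0 < ‖a‖ := norm_pos_iff.2 ha0
  by_contra! hlt
  have hmem : ‖a‖⁻¹ • b ∈ Metric.ball (0 : V) δ := by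
    rw [mem_ball_zero_iff, norm_smul, norm_inv, norm_norm, inv_mul_lt_iff₀ hn, mul_comm]
    rwa [inv_mul_lt_iff₀ hδ] at hlt
  refine hball hmem ⟨‖a‖⁻¹ • a, ⟨?_, C.smul_mem (by positivity) ha⟩, ‖a‖⁻¹ • (b - a),
    C.smul_mem (by positivity) hba, ?_⟩
  · simp [norm_smul, hn.ne']
  · simp only [smul_sub]; abel

/-- The orbit of an interior point of an invariant closed salient cone dominates every orbit. -/
theorem ConvexCone.exists_norm_pow_apply_le_mul {V : Type*} [NormedAddCommGroup V]
    [NormedSpace ℝ V] [FiniteDimensional ℝ V] (C : ConvexCone ℝ V)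
    (hCcl : IsClosed (C : Set V)) (hCsal : ∀ v ∈ C, -v ∈ C → v = 0)
    (f : Module.End ℝ V) (hfC : Set.MapsTo f (C : Set V) (C : Set V))
    {x : V} (hx : x ∈ interior (C : Set V)) (v : V) :
    ∃ K : ℝ, 0 ≤ K ∧ ∀ n : ℕ, ‖(f ^ n) v‖ ≤ K * ‖(f ^ n) x‖ := by
  obtain ⟨K, hK, hnormal⟩ := C.exists_norm_le_mul_norm_of_isClosed hCcl hCsal
  have hpow (n : ℕ) (c : V) (hc : c ∈ C) : (f ^ n) c ∈ C := by
    rw [Module.End.pow_apply]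
    exact hfC.iterate n hc
  have hnhds : ∀ᶠ t : ℝ in 𝓝 0, x + t • v ∈ C ∧ x - t • v ∈ C := by
    have hC : (C : Set V) ∈ 𝓝 x := mem_interior_iff_mem_nhds.1 hx
    refine Filter.Eventually.and ?_ ?_
    · have : Tendsto (fun t : ℝ => x + t • v) (𝓝 0) (𝓝 x) :=
        Continuous.tendsto' (by fun_prop) _ _ (by simp)
      exact this hC
    · have : Tendsto (fun t : ℝ => x - t • v) (𝓝 0) (𝓝 x) :=
        Continuous.tendsto' (by fun_prop) _ _ (by simp)
      exact this hC
  obtain ⟨t, ⟨hp, hm⟩, ht⟩ :=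
    ((hnhds.filter_mono nhdsWithin_le_nhds).and (self_mem_nhdsWithin (s := Set.Ioi 0))).exists
  have ht : 0 < t := ht
  refine ⟨t⁻¹ * (K * 2 + 1), by positivity, fun n => ?_⟩
  have h1 := hnormal ((f ^ n) (x + t • v)) ((2 : ℝ) • (f ^ n) x) (hpow n _ hp) (by
    have := hpow n _ hm
    convert this using 1
    simp only [map_add, map_sub, two_smul]
    abel)
  have h2 : ‖t • (f ^ n) v‖ ≤ ‖(f ^ n) (x + t • v)‖ + ‖(f ^ n) x‖ := by
    have : t • (f ^ n) v = (f ^ n) (x + t • v) - (f ^ n) x := by simp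
    rw [this]
    exact norm_sub_le _ _
  rw [norm_smul, Real.norm_of_nonneg ht.le] at h2
  rw [norm_smul, Real.norm_two] at h1
  rw [mul_assoc, le_inv_mul_iff₀ ht]
  linarith

/-- If every orbit of `f` is dominated by a sequence `a`, then so are the complex coordinates of
every orbit of the complexification of `f`. -/
theorem LinearMap.exists_norm_baseChange_pow_coord_le {V : Type*} [NormedAddCommGroup V]
    [NormedSpace ℝ V] [FiniteDimensional ℝ V] {ι : Type*} (b : Module.Basis ι ℝ V)
    (f : Module.End ℝ V) (a : ℕ → ℝ)
    (h : ∀ v, ∃ K : ℝ, 0 ≤ K ∧ ∀ n : ℕ, ‖(f ^ n) v‖ ≤ K * a n) (i : ι) (w : ℂ ⊗[ℝ] V) :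
    ∃ K : ℝ, ∀ n : ℕ,
      ‖(b.baseChange ℂ).repr (((f.baseChange ℂ : Module.End ℂ (ℂ ⊗[ℝ] V)) ^ n) w) i‖ ≤
        K * a n := by
  induction w with
  | zero => exact ⟨0, by simp⟩
  | add w₁ w₂ h₁ h₂ =>
    obtain ⟨K₁, h₁⟩ := h₁
    obtain ⟨K₂, h₂⟩ := h₂
    refine ⟨K₁ + K₂, fun n => ?_⟩
    rw [map_add, map_add, Finsupp.add_apply, add_mul]
    exact (norm_add_le _ _).trans (add_le_add (h₁ n) (h₂ n))
  | tmul z v =>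
    obtain ⟨K, hK, h⟩ := h v
    set g : V →L[ℝ] ℝ := LinearMap.toContinuousLinearMap (b.coord i) with hg
    refine ⟨‖z‖ * (‖g‖ * K), fun n => ?_⟩
    have hpow : (f.baseChange ℂ : Module.End ℂ (ℂ ⊗[ℝ] V)) ^ n = (f ^ n).baseChange ℂ :=
      (LinearMap.baseChange_pow ℝ ℂ V f n).symm
    have hgv : b.repr ((f ^ n) v) i = g ((f ^ n) v) := rfl
    rw [hpow, LinearMap.baseChange_tmul, Module.Basis.baseChange_repr_tmul, hgv, norm_smul,
      mul_comm, mul_assoc, mul_assoc]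
    gcongr
    exact (g.le_opNorm _).trans (by gcongr; exact h n)

/-- If `f` is an invertible linear map of a finite-dimensional real normed
vector space preserving a closed convex cone `C` that spans `V` and contains no line,
`x` is interior to `C`, and `y = lim fⁿx/‖fⁿx‖` exists, then `f y = r • y` where `r` is
the spectral radius of `f` (the sup of the moduli of the complex eigenvalues of the
complexification of `f`). -/
theorem stmt_0 {V : Type*} [NormedAddCommGroup V] [NormedSpace ℝ V]
    [FiniteDimensional ℝ V] (hV : 0 < Module.finrank ℝ V)
    (f : Module.End ℝ V) (hf : Function.Bijective f)
    (C : ConvexCone ℝ V) (hCcl : IsClosed (C : Set V))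
    (hCspan : Submodule.span ℝ (C : Set V) = ⊤)
    (hCsal : ∀ v ∈ C, -v ∈ C → v = 0)
    (hfC : f '' (C : Set V) = (C : Set V))
    (x : V) (hx : x ∈ interior (C : Set V))
    (y : V)
    (hy : Tendsto (fun n : ℕ => (‖(f ^ n) x‖)⁻¹ • (f ^ n) x) atTop (nhds y)) :
    f y = (sSup ((fun μ : ℂ => ‖μ‖) ''
      spectrum ℂ (LinearMap.baseChange ℂ (f : V →ₗ[ℝ] V)))) • y := by
  have hinj (n : ℕ) : Function.Injective (f ^ n) := by
    rw [Module.End.coe_pow]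
    exact hf.1.iterate n
  have hmaps : Set.MapsTo f (C : Set V) (C : Set V) := Set.mapsTo_iff_image_subset.2 hfC.subset
  have hdom := C.exists_norm_pow_apply_le_mul hCcl hCsal f hmaps hx
  have hx0 : x ≠ 0 := by
    rintro rfl
    have : Nontrivial V := Module.finrank_pos_iff.1 hV
    obtain ⟨v, hv⟩ := exists_ne (0 : V)
    obtain ⟨K, -, h⟩ := hdom v
    exact hv (by simpa using h 0)
  have hpos (n : ℕ) : 0 < ‖(f ^ n) x‖ :=
    norm_pos_iff.2 ((map_ne_zero_iff _ (hinj n)).2 hx0)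
  have hy1 : ‖y‖ = 1 := by
    refine tendsto_nhds_unique hy.norm (tendsto_const_nhds.congr fun n => ?_)
    simp [norm_smul, (hpos n).ne']
  have hy0 : y ≠ 0 := by
    rintro rfl
    simp at hy1
  have hfy : Tendsto (fun n : ℕ => (‖(f ^ n) x‖)⁻¹ • (f ^ (n + 1)) x) atTop (𝓝 (f y)) := by
    refine (((LinearMap.continuous_of_finiteDimensional f).tendsto y).comp hy).congr fun n => ?_
    simp [pow_succ']
  have hratio : Tendsto (fun n : ℕ => ‖(f ^ (n + 1)) x‖ / ‖(f ^ n) x‖) atTop (𝓝 ‖f y‖) := by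
    refine hfy.norm.congr fun n => ?_
    rw [norm_smul, norm_inv, norm_norm, inv_mul_eq_div]
  have heig : f y = ‖f y‖ • y := by
    refine tendsto_nhds_unique hfy
      ((hratio.smul (hy.comp (tendsto_add_atTop_nat 1))).congr fun n => ?_)
    simp only [Function.comp_apply, smul_smul]
    congr 1
    have h1 := (hpos n).ne'
    have h2 := (hpos (n + 1)).ne'
    field_simp
  let b := Module.finBasis ℝ V
  suffices h : IsGreatest ((fun μ : ℂ => ‖μ‖) ''
      spectrum ℂ (LinearMap.baseChange ℂ (f : V →ₗ[ℝ] V))) ‖f y‖ by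
    rw [h.csSup_eq]
    exact heig
  constructor
  · refine ⟨(‖f y‖ : ℂ), ?_, by simp⟩
    refine Module.End.HasEigenvalue.mem_spectrum
      (Module.End.hasEigenvalue_of_hasEigenvector (x := (1 : ℂ) ⊗ₜ[ℝ] y) ⟨?_, ?_⟩)
    · rw [Module.End.mem_eigenspace_iff, LinearMap.baseChange_tmul]
      conv_lhs => rw [heig]
      rw [← TensorProduct.smul_tmul, TensorProduct.smul_tmul', Complex.real_smul, smul_eq_mul]
    · intro h
      refine hy0 (b.ext_elem fun i => ?_)
      have := congrArg (fun w => (b.baseChange ℂ).repr w i) h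
      simpa [Module.Basis.baseChange_repr_tmul] using this
  · rintro _ ⟨μ, hμ, rfl⟩
    obtain ⟨w, hw⟩ := (Module.End.hasEigenvalue_iff_mem_spectrum.2 hμ).exists_hasEigenvector
    obtain ⟨i, hi⟩ : ∃ i, (b.baseChange ℂ).repr w i ≠ 0 := by
      by_contra! h
      exact hw.2 ((b.baseChange ℂ).ext_elem fun i => by simpa using h i)
    obtain ⟨K, hK⟩ := LinearMap.exists_norm_baseChange_pow_coord_le b f
      (fun n => ‖(f ^ n) x‖) hdom i w
    simp only [hw.pow_apply, map_smul, Finsupp.smul_apply, norm_smul, norm_pow] at hK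
    by_contra! hlt
    have hm : 0 < ‖μ‖ := (norm_nonneg _).trans_lt hlt
    have hsum : Summable fun n : ℕ => ‖(f ^ n) x‖ / ‖μ‖ ^ n := by
      refine summable_of_ratio_test_tendsto_lt_one (l := ‖f y‖ / ‖μ‖) ((div_lt_one hm).2 hlt)
        (Eventually.of_forall fun n => (div_pos (hpos n) (by positivity)).ne')
        ((hratio.div_const ‖μ‖).congr fun n => ?_)
      have h1 := (hpos n).ne'
      rw [norm_div, norm_div, norm_norm, norm_norm, norm_pow, norm_pow, norm_norm]
      field_simp
      ring
    have hlim : Tendsto (fun n : ℕ => K * (‖(f ^ n) x‖ / ‖μ‖ ^ n)) atTop (𝓝 0) := by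
      simpa using hsum.tendsto_atTop_zero.const_mul K
    refine hi (norm_le_zero_iff.1 (ge_of_tendsto' hlim fun n => ?_))
    rw [← mul_div_assoc, le_div_iff₀ (by positivity), mul_comm]
    exact hK n
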